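/- For every τ ∈ ℍ and every z ∈ ℂ, both series below converge absolutely and ∑_{n≥0} c_F(n)·j_{w−1}(π² n z)·e^{πinτ} = e^{A(τ)z}·F(τ)·∑_{n≥0} π^{2n}·x(τ)^n·φ_n(u(τ))·z^n. -/

import Mathlib

open Polynomial Complex

noncomputable section

/-- The theta constant `θ(τ) = ∑_{n ∈ ℤ} exp(πin²τ)`. -/
def theta (τ : ℂ) : ℂ := ∑' n : ℤ, Complex.exp (Real.pi * Complex.I * (n : ℂ) ^ 2 * τ)

/-- `θ₂(τ) = ∑_{n ∈ ℤ} exp(πi(n+1/2)²τ)`. -/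
def theta2 (τ : ℂ) : ℂ := ∑' n : ℤ, Complex.exp (Real.pi * Complex.I * ((n : ℂ) + 1/2) ^ 2 * τ)

/-- `θ₄(τ) = ∑_{n ∈ ℤ} (-1)ⁿ exp(πin²τ)`. -/
def theta4 (τ : ℂ) : ℂ :=
  ∑' n : ℤ, (-1 : ℂ) ^ n * Complex.exp (Real.pi * Complex.I * (n : ℂ) ^ 2 * τ)

/-- `x(τ) = -θ₄(τ)⁴`. -/
def xx (τ : ℂ) : ℂ := -(theta4 τ) ^ 4

/-- `y(τ) = θ₂(τ)⁴`. -/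
def yy (τ : ℂ) : ℂ := (theta2 τ) ^ 4

/-- The Hauptmodul `u(τ) = y(τ)/x(τ)`. -/
def uu (τ : ℂ) : ℂ := yy τ / xx τ

/-- `t(τ) = (1/(2πi)) θ'(τ)/θ(τ)`. -/
def tt (τ : ℂ) : ℂ := deriv theta τ / (2 * Real.pi * Complex.I * theta τ)

/-- `A(τ) = -4π² t(τ)`. -/
def AA (τ : ℂ) : ℂ := -4 * (Real.pi : ℂ) ^ 2 * tt τ

/-- `j_w(z) = ∑_{n≥0} (-1)ⁿ Γ(w+1) zⁿ/(n! Γ(n+w+1))`. -/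
def jw (w : ℝ) (z : ℂ) : ℂ :=
  ∑' n : ℕ, (-1 : ℂ) ^ n * (Real.Gamma (w + 1) : ℂ) * z ^ n /
    ((Nat.factorial n : ℂ) * (Real.Gamma (n + w + 1) : ℂ))



open Filter Topology

/-! ### Generic exponential series -/

/-- Absolute summability of an exponential series on the upper half plane. -/
def SmE {ι : Type*} (c : ι → ℂ) (e : ι → ℕ) : Prop :=
  ∀ τ : ℂ, 0 < τ.im → Summable (fun i => ‖c i * Complex.exp (Real.pi * Complex.I * (e i : ℂ) * τ)‖)

/-- The exponential series. -/
def SE {ι : Type*} (c : ι → ℂ) (e : ι → ℕ) (τ : ℂ) : ℂ :=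
  ∑' i, c i * Complex.exp (Real.pi * Complex.I * (e i : ℂ) * τ)

lemma norm_expE (e : ℕ) (τ : ℂ) :
    ‖Complex.exp (Real.pi * Complex.I * (e : ℂ) * τ)‖ = Real.exp (-(Real.pi * e * τ.im)) := by
  rw [Complex.norm_exp]
  congr 1
  simp [Complex.mul_re, Complex.mul_im]

lemma SmE.mul_exp {ι : Type*} {c : ι → ℂ} {e : ι → ℕ} (h : SmE c e) :
    SmE (fun i => (e i : ℂ) * c i) e := by
  intro τ hτ
  have h2 := h (τ / 2) (by simpa using hτ)
  refine Summable.of_nonneg_of_le (fun i => norm_nonneg _) (fun i => ?_)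
    (h2.mul_left (2 / (Real.pi * τ.im)))
  rw [norm_mul, norm_mul, norm_mul, norm_expE, norm_expE]
  have him : (τ / 2).im = τ.im / 2 := by simp
  rw [him]
  have hp := Real.pi_pos
  set v : ℝ := Real.pi * (e i) * (τ.im / 2) with hv
  have h3 : -(Real.pi * (e i) * τ.im) = -v + -v := by rw [hv]; ring
  have h4 : v * Real.exp (-v) ≤ 1 := by
    rw [Real.exp_neg, ← div_eq_mul_inv, div_le_one (Real.exp_pos _)]
    linarith [Real.add_one_le_exp v]
  have h5 : (e i : ℝ) = 2 / (Real.pi * τ.im) * v := by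
    rw [hv]; field_simp
  rw [h3, Real.exp_add, Complex.norm_natCast]
  have h6 : (e i : ℝ) * ‖c i‖ * (Real.exp (-v) * Real.exp (-v))
      = (2 / (Real.pi * τ.im) * (‖c i‖ * Real.exp (-v))) * (v * Real.exp (-v)) := by
    rw [h5]; ring
  rw [h6]
  exact mul_le_of_le_one_right (by positivity) h4

lemma SmE.hasDerivAt {ι : Type*} {c : ι → ℂ} {e : ι → ℕ} (h : SmE c e) {τ : ℂ} (hτ : 0 < τ.im) :
    HasDerivAt (SE c e) (Real.pi * Complex.I * SE (fun i => (e i : ℂ) * c i) e τ) τ := by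
  have hT : IsOpen {s : ℂ | τ.im / 2 < s.im} := isOpen_lt continuous_const Complex.continuous_im
  have hC : IsPreconnected {s : ℂ | τ.im / 2 < s.im} :=
    (convex_halfSpace_im_gt _).isPreconnected
  have hm : τ ∈ {s : ℂ | τ.im / 2 < s.im} := by simp; linarith
  have hu := (h.mul_exp (τ / 2) (by simpa using hτ)).mul_left Real.pi
  have key := hasDerivAt_tsum_of_isPreconnected
    (g := fun i s => c i * Complex.exp (Real.pi * Complex.I * (e i : ℂ) * s))
    (g' := fun i s => Real.pi * Complex.I * ((e i : ℂ) * c i *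
      Complex.exp (Real.pi * Complex.I * (e i : ℂ) * s))) hu hT hC ?_ ?_ hm (h τ hτ).of_norm hm
  · have h2 : Real.pi * Complex.I * SE (fun i => (e i : ℂ) * c i) e τ
      = ∑' i, Real.pi * Complex.I * ((e i : ℂ) * c i *
      Complex.exp (Real.pi * Complex.I * (e i : ℂ) * τ)) := by
      rw [tsum_mul_left]; rfl
    rw [h2]; exact key
  · intro i s hs
    have h1 : HasDerivAt (fun s : ℂ => Real.pi * Complex.I * (e i : ℂ) * s)
        (Real.pi * Complex.I * (e i : ℂ)) s := by
      simpa using (hasDerivAt_id s).const_mul (Real.pi * Complex.I * (e i : ℂ))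
    have h2 := h1.cexp.const_mul (c i)
    refine h2.congr_deriv ?_
    ring
  · intro i s hs
    simp only [Set.mem_ofPred_eq] at hs
    beta_reduce
    rw [norm_mul, norm_mul, norm_mul, norm_mul, norm_mul, norm_mul, norm_expE, norm_expE]
    simp only [Complex.norm_I, mul_one, Complex.norm_real, Real.norm_eq_abs,
      abs_of_pos Real.pi_pos]
    have him : (τ / 2).im = τ.im / 2 := by simp
    rw [him]
    gcongr

lemma SmE.decay {ι : Type*} {c : ι → ℂ} {e : ι → ℕ} (h : SmE c e) (h0 : ∀ i, e i = 0 → c i = 0) :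
    ∃ M : ℝ, 0 ≤ M ∧ ∀ τ : ℂ, 1 ≤ τ.im → ‖SE c e τ‖ ≤ M * Real.exp (-τ.im) := by
  have h1 := h Complex.I (by simp)
  refine ⟨(∑' i, ‖c i * Complex.exp (Real.pi * Complex.I * (e i : ℂ) * Complex.I)‖) * Real.exp 1,
    by positivity, fun τ hτ => ?_⟩
  rw [mul_assoc, ← Real.exp_add]
  rw [← tsum_mul_right]
  refine tsum_of_norm_bounded (h1.mul_right _).hasSum (fun i => ?_)
  rw [norm_mul, norm_mul, norm_expE, norm_expE, mul_assoc ‖c i‖, ← Real.exp_add]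
  rcases Nat.eq_zero_or_pos (e i) with he | he
  · simp [h0 i he]
  · gcongr
    simp only [Complex.I_im, mul_one]
    have hp : 3 < Real.pi := Real.pi_gt_three
    have he' : (1 : ℝ) ≤ e i := by exact_mod_cast he
    nlinarith [mul_nonneg (mul_nonneg Real.pi_pos.le (by linarith : (0 : ℝ) ≤ τ.im - 1))
      (by linarith : (0:ℝ) ≤ e i - 1), mul_nonneg (by linarith : (0:ℝ) ≤ Real.pi - 1) (by linarith : (0 : ℝ) ≤ τ.im - 1)]

lemma SmE.decay_tendsto {ι : Type*} {c : ι → ℂ} {e : ι → ℕ} (h : SmE c e)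
    (h0 : ∀ i, e i = 0 → c i = 0) (t : ℕ → ℂ) {y : ℝ} (hy : 0 < y)
    (him : ∀ n, (t n).im = 2 ^ n * y) :
    Tendsto (fun n : ℕ => (4 : ℂ) ^ n * SE c e (t n)) atTop (𝓝 0) := by
  obtain ⟨M, hM, hb⟩ := h.decay h0
  have ht : Tendsto (fun n : ℕ => (2 : ℝ) ^ n * y) atTop atTop :=
    (tendsto_pow_atTop_atTop_of_one_lt (by norm_num)).atTop_mul_const hy
  have h2 := (Real.tendsto_pow_mul_exp_neg_atTop_nhds_zero 2).comp ht
  have h3 := h2.const_mul (M / y ^ 2)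
  rw [mul_zero] at h3
  refine squeeze_zero_norm' ?_ h3
  filter_upwards [ht.eventually_ge_atTop 1] with n hn
  have := hb (t n) (by rw [him]; exact hn)
  rw [him] at this
  rw [norm_mul, norm_pow]
  simp only [Function.comp]
  have h4 : M / y ^ 2 * ((2 ^ n * y) ^ 2 * Real.exp (-(2 ^ n * y)))
    = 4 ^ n * (M * Real.exp (-(2 ^ n * y))) := by
    have : (4:ℝ) ^ n = (2 ^ n) ^ 2 := by rw [← pow_mul, mul_comm, pow_mul]; norm_num
    rw [this]; field_simp
  rw [h4]
  have h5 : ‖(4:ℂ)‖ = 4 := by norm_num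
  rw [h5]
  gcongr

lemma SmE.decay_tendsto' {ι : Type*} {c : ι → ℂ} {e : ι → ℕ} (h : SmE c e)
    (h0 : ∀ i, e i = 0 → c i = 0) (t : ℕ → ℂ) {y : ℝ} (hy : 0 < y)
    (him : ∀ n, (t n).im = 2 ^ n * y) :
    Tendsto (fun n : ℕ => SE c e (t n)) atTop (𝓝 0) := by
  refine squeeze_zero_norm (fun n => ?_) (tendsto_zero_iff_norm_tendsto_zero.1
    (h.decay_tendsto h0 t hy him))
  rw [norm_mul, norm_pow]
  have h5 : ‖(4:ℂ)‖ = 4 := by norm_num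
  rw [h5]
  exact le_mul_of_one_le_left (norm_nonneg _) (one_le_pow₀ (by norm_num))


/-! ### Theta constants -/

lemma tsum_prod_split (f : ℤ × ℤ → ℂ) (hf : Summable f) :
    ∑' z, f z = (∑' z : ℤ × ℤ, f (z.1 + z.2, z.1 - z.2))
      + ∑' z : ℤ × ℤ, f (z.1 + z.2 + 1, z.1 - z.2) := by
  let k : (ℤ × ℤ) ⊕ (ℤ × ℤ) → ℤ × ℤ := Sum.elim (fun z => (z.1 + z.2, z.1 - z.2))
    (fun z => (z.1 + z.2 + 1, z.1 - z.2))
  have hk : Function.Bijective k := by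
    constructor
    · rintro (⟨p, r⟩ | ⟨p, r⟩) (⟨p', r'⟩ | ⟨p', r'⟩) h <;>
        simp [k] at h ⊢ <;> omega
    · rintro ⟨m, n⟩
      rcases Int.even_or_odd' (m + n) with ⟨l, hl | hl⟩
      · refine ⟨Sum.inl (l, l - n), ?_⟩
        simp [k]; omega
      · refine ⟨Sum.inr (l, l - n), ?_⟩
        simp [k]; omega
  have hs : Summable (f ∘ k) := hf.comp_injective hk.1
  rw [← (Equiv.ofBijective k hk).tsum_eq f]
  exact Summable.tsum_sum (f := f ∘ k) (hs.comp_injective Sum.inl_injective)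
    (hs.comp_injective Sum.inr_injective)

/-- General term of theta. -/
def ee (τ v : ℂ) : ℂ := Complex.exp (Real.pi * Complex.I * v ^ 2 * τ)

lemma ee_mul (τ v w : ℂ) {v' w' : ℂ} (h : v ^ 2 + w ^ 2 = 2 * v' ^ 2 + 2 * w' ^ 2) :
    ee τ v * ee τ w = ee (2 * τ) v' * ee (2 * τ) w' := by
  unfold ee
  rw [← Complex.exp_add, ← Complex.exp_add]
  congr 1
  linear_combination (Real.pi * Complex.I * τ) * h

lemma summable_ee {τ : ℂ} (hτ : 0 < τ.im) : Summable (fun n : ℤ => ‖ee τ n‖) := by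
  have := ((summable_jacobiTheta₂_term_iff 0 τ).2 hτ).norm
  refine this.congr (fun n => ?_)
  simp [jacobiTheta₂_term, ee]

lemma ee_half (τ : ℂ) (n : ℤ) : ee τ ((n : ℂ) + 1 / 2) =
    Complex.exp (Real.pi * Complex.I * τ / 4) * jacobiTheta₂_term n (τ / 2) τ := by
  rw [jacobiTheta₂_term, ee, ← Complex.exp_add]
  congr 1
  ring

lemma summable_ee_half {τ : ℂ} (hτ : 0 < τ.im) : Summable (fun n : ℤ => ‖ee τ ((n : ℂ) + 1 / 2)‖) := by
  have := (((summable_jacobiTheta₂_term_iff (τ / 2) τ).2 hτ).norm).mul_left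
    ‖Complex.exp (Real.pi * Complex.I * τ / 4)‖
  refine this.congr (fun n => ?_)
  rw [ee_half, norm_mul]

lemma two_mul_im {τ : ℂ} (hτ : 0 < τ.im) : 0 < (2 * τ).im := by
  simpa using hτ

lemma norm_neg_one_zpow (n : ℤ) : ‖(-1 : ℂ) ^ n‖ = 1 := by
  rw [norm_zpow]; simp

lemma summable_ee_sgn {τ : ℂ} (hτ : 0 < τ.im) : Summable (fun n : ℤ => ‖(-1 : ℂ) ^ n * ee τ n‖) := by
  refine (summable_ee hτ).congr (fun n => ?_)
  rw [norm_mul, norm_neg_one_zpow, one_mul]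

lemma summable_ee_half_sgn {τ : ℂ} (hτ : 0 < τ.im) :
    Summable (fun n : ℤ => ‖(-1 : ℂ) ^ n * ee τ ((n : ℂ) + 1 / 2)‖) := by
  refine (summable_ee_half hτ).congr (fun n => ?_)
  rw [norm_mul, norm_neg_one_zpow, one_mul]

lemma theta_sq {τ : ℂ} (hτ : 0 < τ.im) :
    theta τ ^ 2 = theta (2 * τ) ^ 2 + theta2 (2 * τ) ^ 2 := by
  have h1 := summable_ee hτ
  have h2 := summable_ee (two_mul_im hτ)
  have h3 := summable_ee_half (two_mul_im hτ)
  change (∑' n : ℤ, ee τ n) ^ 2 = (∑' n : ℤ, ee (2 * τ) n) ^ 2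
    + (∑' n : ℤ, ee (2 * τ) ((n : ℂ) + 1 / 2)) ^ 2
  rw [sq, sq, sq, tsum_mul_tsum_of_summable_norm h1 h1, tsum_mul_tsum_of_summable_norm h2 h2,
    tsum_mul_tsum_of_summable_norm h3 h3,
    tsum_prod_split _ (summable_mul_of_summable_norm h1 h1)]
  congr 1
  · refine tsum_congr (fun z => ee_mul _ _ _ ?_)
    push_cast; ring
  · refine tsum_congr (fun z => ee_mul _ _ _ ?_)
    push_cast; ring

lemma theta2_sq {τ : ℂ} (hτ : 0 < τ.im) :
    theta2 τ ^ 2 = 2 * theta (2 * τ) * theta2 (2 * τ) := by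
  have h1 := summable_ee_half hτ
  have h2 := summable_ee (two_mul_im hτ)
  have h3 := summable_ee_half (two_mul_im hτ)
  change (∑' n : ℤ, ee τ ((n : ℂ) + 1 / 2)) ^ 2 = 2 * (∑' n : ℤ, ee (2 * τ) n)
    * (∑' n : ℤ, ee (2 * τ) ((n : ℂ) + 1 / 2))
  rw [sq, tsum_mul_tsum_of_summable_norm h1 h1, mul_assoc, 
    tsum_prod_split _ (summable_mul_of_summable_norm h1 h1), two_mul]
  congr 1
  · rw [mul_comm, tsum_mul_tsum_of_summable_norm h3 h2]
    refine tsum_congr (fun z => ee_mul _ _ _ ?_)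
    push_cast; ring
  · rw [← (Equiv.addRight (1 : ℤ)).tsum_eq (fun n : ℤ => ee (2 * τ) n)]
    have h2' : Summable (fun n : ℤ => ‖ee (2 * τ) ((Equiv.addRight (1 : ℤ) n : ℤ) : ℂ)‖) :=
      h2.comp_injective (Equiv.addRight (1 : ℤ)).injective
    rw [tsum_mul_tsum_of_summable_norm h2' h3]
    refine tsum_congr (fun z => ee_mul _ _ _ ?_)
    simp only [Equiv.coe_addRight]
    push_cast; ring

lemma sgn_half_zero (τ : ℂ) : ∑' n : ℤ, (-1 : ℂ) ^ n * ee τ ((n : ℂ) + 1 / 2) = 0 := by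
  have h : ∑' n : ℤ, (-1 : ℂ) ^ n * ee τ ((n : ℂ) + 1 / 2)
      = - ∑' n : ℤ, (-1 : ℂ) ^ n * ee τ ((n : ℂ) + 1 / 2) := by
    conv_lhs => rw [← (Equiv.subLeft (-1 : ℤ)).tsum_eq]
    rw [← tsum_neg]
    refine tsum_congr (fun n => ?_)
    simp only [Equiv.subLeft_apply]
    have h2 : (-1 : ℂ) ^ (-1 - n) = - (-1) ^ n := by
      rw [zpow_sub₀ (by norm_num), div_eq_mul_inv, ← inv_zpow]
      norm_num
    have : ee τ (((-1 - n : ℤ) : ℂ) + 1 / 2) = ee τ ((n : ℂ) + 1 / 2) := by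
      unfold ee; congr 1; push_cast; ring
    rw [this, h2]
    ring
  linear_combination h / 2

lemma theta_mul_theta4 {τ : ℂ} (hτ : 0 < τ.im) :
    theta τ * theta4 τ = theta4 (2 * τ) ^ 2 := by
  have h1 := summable_ee hτ
  have h2 := summable_ee_sgn hτ
  have h3 := summable_ee_sgn (two_mul_im hτ)
  have h4 := summable_ee_half_sgn (two_mul_im hτ)
  change (∑' n : ℤ, ee τ n) * (∑' n : ℤ, (-1 : ℂ) ^ n * ee τ n) =
    (∑' n : ℤ, (-1 : ℂ) ^ n * ee (2 * τ) n) ^ 2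
  rw [tsum_mul_tsum_of_summable_norm h1 h2,
    tsum_prod_split _ (summable_mul_of_summable_norm h1 h2)]
  have h0 := sgn_half_zero (2 * τ)
  have hs : ∀ p r : ℤ, (-1 : ℂ) ^ (p - r) = (-1) ^ p * (-1) ^ r := by
    intro p r
    rw [zpow_sub₀ (by norm_num), div_eq_mul_inv, ← inv_zpow]
    norm_num
  have h5 : ∑' z : ℤ × ℤ, ee τ ((z.1 + z.2 + 1 : ℤ) : ℂ) * ((-1 : ℂ) ^ (z.1 - z.2) *
      ee τ ((z.1 - z.2 : ℤ) : ℂ))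
      = (∑' n : ℤ, (-1 : ℂ) ^ n * ee (2 * τ) ((n : ℂ) + 1 / 2)) *
       (∑' n : ℤ, (-1 : ℂ) ^ n * ee (2 * τ) ((n : ℂ) + 1 / 2)) := by
    rw [tsum_mul_tsum_of_summable_norm h4 h4]
    refine tsum_congr (fun z => ?_)
    rw [hs]
    have := ee_mul τ ((z.1 + z.2 + 1 : ℤ) : ℂ) ((z.1 - z.2 : ℤ) : ℂ) (v' := (z.1 : ℂ) + 1 / 2)
      (w' := (z.2 : ℂ) + 1 / 2) (by push_cast; ring)
    linear_combination ((-1) ^ z.1 * (-1) ^ z.2) * this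
  have h6 : ∑' z : ℤ × ℤ, ee τ ((z.1 + z.2 : ℤ) : ℂ) * ((-1 : ℂ) ^ (z.1 - z.2) *
      ee τ ((z.1 - z.2 : ℤ) : ℂ))
      = (∑' n : ℤ, (-1 : ℂ) ^ n * ee (2 * τ) n) ^ 2 := by
    rw [sq, tsum_mul_tsum_of_summable_norm h3 h3]
    refine tsum_congr (fun z => ?_)
    rw [hs]
    have := ee_mul τ ((z.1 + z.2 : ℤ) : ℂ) ((z.1 - z.2 : ℤ) : ℂ) (v' := (z.1 : ℂ))
      (w' := (z.2 : ℂ)) (by push_cast; ring)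
    linear_combination ((-1) ^ z.1 * (-1) ^ z.2) * this
  rw [h5, h6, h0]
  ring

lemma exp_pi_sq (n : ℤ) : Complex.exp (Real.pi * Complex.I * (n : ℂ) ^ 2) = (-1) ^ n := by
  have h : (Real.pi * Complex.I * (n : ℂ) ^ 2 : ℂ) = ((n ^ 2 : ℤ) : ℂ) * (Real.pi * Complex.I) := by
    push_cast; ring
  rw [h, Complex.exp_int_mul, Complex.exp_pi_mul_I]
  rcases Int.even_or_odd n with hn | hn
  · rw [hn.neg_one_zpow, (hn.pow_of_ne_zero (by norm_num)).neg_one_zpow]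
  · rw [hn.neg_one_zpow, (hn.pow).neg_one_zpow]

lemma theta4_eq (τ : ℂ) : theta4 τ = theta (τ + 1) := by
  unfold theta4 theta
  refine tsum_congr (fun n => ?_)
  rw [← exp_pi_sq, ← Complex.exp_add]
  congr 1; ring

lemma theta_add_two (τ : ℂ) : theta (τ + 2) = theta τ := by
  unfold theta
  refine tsum_congr (fun n => ?_)
  have h : Real.pi * Complex.I * (n : ℂ) ^ 2 * (τ + 2) = Real.pi * Complex.I * (n : ℂ) ^ 2 * τ
    + Real.pi * Complex.I * (n : ℂ) ^ 2 + Real.pi * Complex.I * (n : ℂ) ^ 2 := by ring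
  rw [h, Complex.exp_add, Complex.exp_add, exp_pi_sq, mul_assoc, ← mul_zpow]
  simp

lemma theta2_add_two (τ : ℂ) : theta2 (τ + 2) = Complex.I * theta2 τ := by
  unfold theta2
  rw [← tsum_mul_left]
  refine tsum_congr (fun n => ?_)
  have h : Real.pi * Complex.I * ((n : ℂ) + 1 / 2) ^ 2 * (τ + 2) =
    Real.pi * Complex.I / 2 + Real.pi * Complex.I * ((n : ℂ) + 1 / 2) ^ 2 * τ
    + ((n ^ 2 + n : ℤ) : ℂ) * (2 * Real.pi * Complex.I) := by push_cast; ring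
  rw [h, Complex.exp_add, Complex.exp_int_mul_two_pi_mul_I, mul_one, Complex.exp_add]
  congr 1
  have : (Real.pi * Complex.I / 2 : ℂ) = Real.pi / 2 * Complex.I := by ring
  rw [this, Complex.exp_pi_div_two_mul_I]

lemma theta4_sq {τ : ℂ} (hτ : 0 < τ.im) :
    theta4 τ ^ 2 = theta (2 * τ) ^ 2 - theta2 (2 * τ) ^ 2 := by
  rw [theta4_eq, theta_sq (by simpa using hτ), mul_add, mul_one, theta_add_two, theta2_add_two,
    mul_pow, Complex.I_sq]
  ring


/-! ### q-expansions of theta constants -/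

/-- coefficients of theta - 1 -/
def cT (n : ℤ) : ℂ := if n = 0 then 0 else 1
/-- exponents of theta -/
def eT (n : ℤ) : ℕ := n.natAbs ^ 2
/-- coefficients for theta2 -/
def cU (n : ℤ) : ℂ := if n = 0 ∨ n = -1 then 0 else 1
/-- exponents for theta2 -/
def eU (n : ℤ) : ℕ := (n ^ 2 + n).natAbs

lemma eT_cast (n : ℤ) : (eT n : ℂ) = (n : ℂ) ^ 2 := by
  have : ((eT n : ℤ)) = n ^ 2 := by simp [eT]
  exact_mod_cast congrArg (fun z : ℤ => (z : ℂ)) this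

lemma eU_cast (n : ℤ) : (eU n : ℂ) = (n : ℂ) ^ 2 + n := by
  have h0 : 0 ≤ n ^ 2 + n := by
    rcases le_or_gt 0 n with h | h <;> nlinarith
  have : ((eU n : ℤ)) = n ^ 2 + n := by simp [eU, abs_of_nonneg h0]
  exact_mod_cast congrArg (fun z : ℤ => (z : ℂ)) this

lemma cT_zero (n : ℤ) (h : eT n = 0) : cT n = 0 := by
  simp [eT] at h
  simp [cT, h]

lemma cU_zero (n : ℤ) (h : eU n = 0) : cU n = 0 := by
  have h1 : n ^ 2 + n = 0 := by simpa [eU] using h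
  have h2 : n * (n + 1) = 0 := by rw [← h1]; ring
  rcases mul_eq_zero.1 h2 with h3 | h3
  · simp [cU, h3]
  · have : n = -1 := by omega
    simp [cU, this]

lemma smT : SmE cT eT := by
  intro τ hτ
  refine Summable.of_nonneg_of_le (fun i => norm_nonneg _) (fun i => ?_) (summable_ee hτ)
  rw [eT_cast]
  unfold cT ee
  split_ifs <;> simp

lemma smU : SmE cU eU := by
  intro τ hτ
  refine Summable.of_nonneg_of_le (fun i => norm_nonneg _) (fun i => ?_)
    ((summable_jacobiTheta₂_term_iff (τ / 2) τ).2 hτ).norm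
  have : jacobiTheta₂_term i (τ / 2) τ = Complex.exp (Real.pi * Complex.I * (eU i : ℂ) * τ) := by
    rw [eU_cast, jacobiTheta₂_term]; congr 1; ring
  rw [this]
  unfold cU
  split_ifs <;> simp

/-- first derived series -/
def T1 : ℂ → ℂ := SE (fun n => (eT n : ℂ) * cT n) eT
/-- second derived series -/
def T2 : ℂ → ℂ := SE (fun n => (eT n : ℂ) * ((eT n : ℂ) * cT n)) eT
/-- first derived series -/
def U1 : ℂ → ℂ := SE (fun n => (eU n : ℂ) * cU n) eU

lemma theta_eq {τ : ℂ} (hτ : 0 < τ.im) : theta τ = 1 + SE cT eT τ := by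
  have h1 := (smT τ hτ).of_norm.hasSum
  have h2 := hasSum_ite_eq (0 : ℤ) (1 : ℂ)
  have h3 := (h2.add h1).tsum_eq
  unfold SE
  rw [← h3]
  unfold theta
  refine tsum_congr (fun n => ?_)
  rw [eT_cast]
  by_cases hn : n = 0 <;> simp [cT, hn]

lemma theta2_eq {τ : ℂ} (hτ : 0 < τ.im) :
    theta2 τ = Complex.exp (Real.pi * Complex.I / 4 * τ) * (2 + SE cU eU τ) := by
  have h1 := (smU τ hτ).of_norm.hasSum
  have h2 := hasSum_ite_eq (0 : ℤ) (1 : ℂ)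
  have h2' := hasSum_ite_eq (-1 : ℤ) (1 : ℂ)
  have h3 := ((h2.add h2').add h1).tsum_eq
  unfold SE
  have h4 : (1 + 1 : ℂ) = 2 := by norm_num
  rw [h4] at h3
  rw [← h3, ← tsum_mul_left]
  unfold theta2
  refine tsum_congr (fun n => ?_)
  rw [eU_cast]
  have h5 : Real.pi * Complex.I * ((n : ℂ) + 1 / 2) ^ 2 * τ = Real.pi * Complex.I / 4 * τ +
    Real.pi * Complex.I * ((n : ℂ) ^ 2 + n) * τ := by ring
  rw [h5, Complex.exp_add]
  congr 1
  by_cases hn : n = 0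
  · simp [cU, hn]
  · by_cases hn' : n = -1 
    · simp [cU, hn']
    · simp [cU, hn, hn']

lemma isOpen_H : IsOpen {s : ℂ | 0 < s.im} := isOpen_lt continuous_const Complex.continuous_im

lemma ev_H {τ : ℂ} (hτ : 0 < τ.im) : ∀ᶠ s in 𝓝 τ, 0 < s.im := isOpen_H.mem_nhds hτ

lemma hd_theta {τ : ℂ} (hτ : 0 < τ.im) : HasDerivAt theta (Real.pi * Complex.I * T1 τ) τ := by
  refine ((smT.hasDerivAt hτ).const_add 1).congr_of_eventuallyEq ?_
  filter_upwards [ev_H hτ] with s hs using theta_eq hs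

lemma hd_T1 {τ : ℂ} (hτ : 0 < τ.im) : HasDerivAt T1 (Real.pi * Complex.I * T2 τ) τ :=
  smT.mul_exp.hasDerivAt hτ

lemma hd_theta2 {τ : ℂ} (hτ : 0 < τ.im) : HasDerivAt theta2
    (Real.pi * Complex.I * (theta2 τ / 4 + Complex.exp (Real.pi * Complex.I / 4 * τ) * U1 τ)) τ := by
  have h1 : HasDerivAt (fun s : ℂ => Real.pi * Complex.I / 4 * s) (Real.pi * Complex.I / 4) τ := by
    simpa using (hasDerivAt_id τ).const_mul (Real.pi * Complex.I / 4)
  have h2 := h1.cexp.mul ((smU.hasDerivAt hτ).const_add 2)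
  have h3 := h2.congr_of_eventuallyEq (f₁ := theta2) (by
    filter_upwards [ev_H hτ] with s hs using theta2_eq hs)
  refine h3.congr_deriv ?_
  rw [theta2_eq hτ]
  unfold U1
  ring

lemma hd_theta4 {τ : ℂ} (hτ : 0 < τ.im) :
    HasDerivAt theta4 (Real.pi * Complex.I * T1 (τ + 1)) τ := by
  have h := (hd_theta (τ := τ + 1) (by simpa using hτ)).comp_add_const τ 1
  refine h.congr_of_eventuallyEq (Eventually.of_forall theta4_eq)

lemma tendsto_theta (t : ℕ → ℂ) {y : ℝ} (hy : 0 < y) (him : ∀ n, (t n).im = 2 ^ n * y) :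
    Tendsto (fun n => theta (t n)) atTop (𝓝 1) := by
  have h := (smT.decay_tendsto' cT_zero t hy him).const_add 1
  rw [add_zero] at h
  refine h.congr (fun n => ?_)
  rw [theta_eq]
  rw [him]; positivity

lemma im_pow (τ : ℂ) (n : ℕ) : (2 ^ n * τ).im = 2 ^ n * τ.im := by
  have : ((2 : ℂ) ^ n) = (((2 : ℝ) ^ n : ℝ) : ℂ) := by push_cast; rfl
  rw [this, Complex.im_ofReal_mul]

lemma im_pow_pos {τ : ℂ} (hτ : 0 < τ.im) (n : ℕ) : 0 < (2 ^ n * τ).im := by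
  rw [im_pow]; positivity

lemma theta_ne_zero {τ : ℂ} (hτ : 0 < τ.im) : theta τ ≠ 0 := by
  intro h0
  let t : ℕ → ℂ := fun n => Nat.rec τ (fun _ s => 2 * s + 1) n
  have him : ∀ n, (t n).im = 2 ^ n * τ.im := by
    intro n
    induction n with
    | zero => simp [t]
    | succ n ih =>
      have : t (n + 1) = 2 * t n + 1 := rfl
      rw [this]; simp [ih]; ring
  have hz : ∀ n, theta (t n) = 0 := by
    intro n
    induction n with
    | zero => exact h0
    | succ n ih =>
      have : t (n + 1) = 2 * t n + 1 := rfl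
      have h1 := theta_mul_theta4 (τ := t n) (by rw [him]; positivity)
      rw [ih, zero_mul, theta4_eq] at h1
      rw [this]
      exact pow_eq_zero_iff (two_ne_zero) |>.1 h1.symm
  have := tendsto_theta t hτ him
  simp only [hz] at this
  exact zero_ne_one (tendsto_nhds_unique tendsto_const_nhds this)

lemma theta4_ne_zero {τ : ℂ} (hτ : 0 < τ.im) : theta4 τ ≠ 0 := by
  rw [theta4_eq]; exact theta_ne_zero (by simpa using hτ)

lemma theta2_ne_zero {τ : ℂ} (hτ : 0 < τ.im) : theta2 τ ≠ 0 := by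
  intro h0
  have hz : ∀ n : ℕ, theta2 (2 ^ n * τ) = 0 := by
    intro n
    induction n with
    | zero => simpa using h0
    | succ n ih =>
      have h1 := theta2_sq (im_pow_pos hτ n)
      rw [ih] at h1
      have h2 := theta_ne_zero (two_mul_im (im_pow_pos hτ n))
      have h3 : theta2 (2 * (2 ^ n * τ)) = 0 := by
        have : theta (2 * (2 ^ n * τ)) * theta2 (2 * (2 ^ n * τ)) = 0 := by
          linear_combination -h1 / 2
        exact (mul_eq_zero.1 this).resolve_left h2
      rw [pow_succ, mul_comm _ (2 : ℂ), mul_assoc]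
      exact h3
  have h4 : ∀ n : ℕ, 2 + SE cU eU (2 ^ n * τ) = 0 := by
    intro n
    have := hz n
    rw [theta2_eq (im_pow_pos hτ n)] at this
    exact (mul_eq_zero.1 this).resolve_left (Complex.exp_ne_zero _)
  have h5 := (smU.decay_tendsto' cU_zero (fun n => 2 ^ n * τ) hτ (im_pow τ)).const_add 2
  simp only [h4, add_zero] at h5
  exact two_ne_zero (tendsto_nhds_unique tendsto_const_nhds h5).symm


/-! ### Differential equations -/

/-- log derivative of theta -/
def ss (τ : ℂ) : ℂ := T1 τ / theta τ
/-- log derivative of theta2 -/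
def vv (τ : ℂ) : ℂ := 1 / 4 + Complex.exp (Real.pi * Complex.I / 4 * τ) * U1 τ / theta2 τ
/-- log derivative of theta4 -/
def ww (τ : ℂ) : ℂ := T1 (τ + 1) / theta4 τ

lemma hs_theta {τ : ℂ} (hτ : 0 < τ.im) :
    HasDerivAt theta (Real.pi * Complex.I * (theta τ * ss τ)) τ := by
  refine (hd_theta hτ).congr_deriv ?_
  have := theta_ne_zero hτ
  unfold ss; field_simp

lemma hs_theta2 {τ : ℂ} (hτ : 0 < τ.im) :
    HasDerivAt theta2 (Real.pi * Complex.I * (theta2 τ * vv τ)) τ := by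
  refine (hd_theta2 hτ).congr_deriv ?_
  have := theta2_ne_zero hτ
  unfold vv; field_simp

lemma hs_theta4 {τ : ℂ} (hτ : 0 < τ.im) :
    HasDerivAt theta4 (Real.pi * Complex.I * (theta4 τ * ww τ)) τ := by
  refine (hd_theta4 hτ).congr_deriv ?_
  have := theta4_ne_zero hτ
  unfold ww; field_simp

lemma pi_I_ne : (Real.pi * Complex.I : ℂ) ≠ 0 := by
  simp [Real.pi_ne_zero]

lemma hd_two {f : ℂ → ℂ} {f' τ : ℂ} (h : HasDerivAt f f' (2 * τ)) :
    HasDerivAt (fun s => f (2 * s)) (2 * f') τ := by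
  have h1 : HasDerivAt (fun s : ℂ => 2 * s) 2 τ := by
    simpa using (hasDerivAt_id τ).const_mul (2 : ℂ)
  have h2 := HasDerivAt.comp τ h h1
  rw [mul_comm] at h2
  exact h2

lemma deriv_eq_of_eqOn {f g : ℂ → ℂ} {f' g' τ : ℂ} (hτ : 0 < τ.im)
    (hf : HasDerivAt f f' τ) (hg : HasDerivAt g g' τ) (h : ∀ s : ℂ, 0 < s.im → f s = g s) :
    f' = g' :=
  hf.unique (hg.congr_of_eventuallyEq (by filter_upwards [ev_H hτ] with s hs using h s hs))

lemma rel_theta {τ : ℂ} (hτ : 0 < τ.im) : theta τ ^ 2 * ss τ =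
    2 * (theta (2 * τ) ^ 2 * ss (2 * τ) + theta2 (2 * τ) ^ 2 * vv (2 * τ)) := by
  have h2 := two_mul_im hτ
  have h := deriv_eq_of_eqOn hτ ((hs_theta hτ).fun_pow 2)
    (((hd_two (hs_theta h2)).fun_pow 2).fun_add ((hd_two (hs_theta2 h2)).fun_pow 2)) (fun s hs => theta_sq hs)
  apply mul_left_cancel₀ pi_I_ne
  push_cast at h
  linear_combination h / 2

lemma rel_theta4 {τ : ℂ} (hτ : 0 < τ.im) : theta4 τ ^ 2 * ww τ =
    2 * (theta (2 * τ) ^ 2 * ss (2 * τ) - theta2 (2 * τ) ^ 2 * vv (2 * τ)) := by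
  have h2 := two_mul_im hτ
  have h := deriv_eq_of_eqOn hτ ((hs_theta4 hτ).fun_pow 2)
    (((hd_two (hs_theta h2)).fun_pow 2).fun_sub ((hd_two (hs_theta2 h2)).fun_pow 2)) (fun s hs => theta4_sq hs)
  apply mul_left_cancel₀ pi_I_ne
  push_cast at h
  linear_combination h / 2

lemma rel_theta2 {τ : ℂ} (hτ : 0 < τ.im) : vv τ = ss (2 * τ) + vv (2 * τ) := by
  have h2 := two_mul_im hτ
  have h := deriv_eq_of_eqOn hτ ((hs_theta2 hτ).fun_pow 2)
    (((hd_two (hs_theta h2)).const_mul 2).fun_mul (hd_two (hs_theta2 h2))) (fun s hs => theta2_sq hs)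
  apply mul_left_cancel₀ (pow_ne_zero 2 (theta2_ne_zero hτ))
  apply mul_left_cancel₀ pi_I_ne
  push_cast at h
  linear_combination h / 2 - Real.pi * Complex.I * (ss (2 * τ) + vv (2 * τ)) * theta2_sq hτ

lemma theta4_two_pow4 {τ : ℂ} (hτ : 0 < τ.im) :
    theta4 (2 * τ) ^ 4 = theta τ ^ 2 * theta4 τ ^ 2 := by
  have := theta_mul_theta4 hτ
  linear_combination (-(theta τ * theta4 τ) - theta4 (2 * τ) ^ 2) * this

lemma hh_step {τ : ℂ} (hτ : 0 < τ.im) :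
    (vv τ - ss τ) / theta4 τ ^ 4 = (vv (2 * τ) - ss (2 * τ)) / theta4 (2 * τ) ^ 4 := by
  have h1 := theta_ne_zero hτ
  have h2 := theta4_ne_zero hτ
  rw [theta4_two_pow4 hτ, div_eq_div_iff (by positivity) (by positivity)]
  have : (vv τ - ss τ) * theta τ ^ 2 = (vv (2 * τ) - ss (2 * τ)) * theta4 τ ^ 2 := by
    rw [sub_mul, mul_comm (ss τ), rel_theta hτ, rel_theta2 hτ, theta_sq hτ, theta4_sq hτ]
    ring
  linear_combination theta4 τ ^ 2 * this

lemma step_iter {f : ℂ → ℂ} {m : ℂ} (hf : ∀ τ : ℂ, 0 < τ.im → f τ = m * f (2 * τ)) {τ : ℂ} (hτ : 0 < τ.im)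
    (n : ℕ) : f τ = m ^ n * f (2 ^ n * τ) := by
  induction n with
  | zero => simp
  | succ n ih =>
    rw [ih, hf _ (im_pow_pos hτ n), pow_succ, pow_succ, mul_comm _ (2 : ℂ), mul_assoc, mul_assoc]

lemma smT0 (n : ℤ) (h : eT n = 0) : (eT n : ℂ) * cT n = 0 := by rw [cT_zero n h, mul_zero]
lemma smT00 (n : ℤ) (h : eT n = 0) : (eT n : ℂ) * ((eT n : ℂ) * cT n) = 0 := by
  rw [cT_zero n h, mul_zero, mul_zero]
lemma smU0 (n : ℤ) (h : eU n = 0) : (eU n : ℂ) * cU n = 0 := by rw [cU_zero n h, mul_zero]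

lemma im_pow_add (τ : ℂ) (n : ℕ) : (2 ^ n * τ + 1).im = 2 ^ n * τ.im := by
  rw [Complex.add_im, im_pow]; simp

lemma tendsto_theta4 {τ : ℂ} (hτ : 0 < τ.im) :
    Tendsto (fun n : ℕ => theta4 (2 ^ n * τ)) atTop (𝓝 1) := by
  simp only [theta4_eq]
  exact tendsto_theta _ hτ (im_pow_add τ)

lemma vv_eq {τ : ℂ} (hτ : 0 < τ.im) : vv τ = 1 / 4 + U1 τ / (2 + SE cU eU τ) := by
  unfold vv
  rw [theta2_eq hτ, mul_div_mul_left _ _ (Complex.exp_ne_zero _)]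

/-- First derivative identity. -/
lemma vv_sub_ss {τ : ℂ} (hτ : 0 < τ.im) : vv τ = ss τ + theta4 τ ^ 4 / 4 := by
  have h1 := fun n => step_iter (f := fun τ => (vv τ - ss τ) / theta4 τ ^ 4) (m := 1)
    (fun τ hτ => by simpa using hh_step hτ) hτ n
  simp only [one_pow, one_mul] at h1
  have hT := tendsto_theta _ hτ (im_pow τ)
  have hT1 : Tendsto (fun n : ℕ => T1 (2 ^ n * τ)) atTop (𝓝 0) :=
    smT.mul_exp.decay_tendsto' smT0 _ hτ (im_pow τ)
  have hU1 : Tendsto (fun n : ℕ => U1 (2 ^ n * τ)) atTop (𝓝 0) :=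
    smU.mul_exp.decay_tendsto' smU0 _ hτ (im_pow τ)
  have hU := (smU.decay_tendsto' cU_zero _ hτ (im_pow τ)).const_add 2
  have hv := (hU1.div hU (by norm_num)).const_add (1 / 4 : ℂ)
  have hs := hT1.div hT (by norm_num)
  have h4 := (tendsto_theta4 hτ).pow 4
  have hl := (hv.sub hs).div h4 (by norm_num)
  have hc : (fun n : ℕ => (vv (2 ^ n * τ) - ss (2 ^ n * τ)) / theta4 (2 ^ n * τ) ^ 4) =
      fun _ => (vv τ - ss τ) / theta4 τ ^ 4 := by
    funext n; exact (h1 n).symm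
  have hl2 : Tendsto (fun n : ℕ => (vv (2 ^ n * τ) - ss (2 ^ n * τ)) / theta4 (2 ^ n * τ) ^ 4) atTop
      (𝓝 ((1 / 4 + 0 / (2 + 0) - 0 / 1) / 1 ^ 4)) := by
    refine hl.congr (fun n => ?_)
    simp only [Pi.div_apply]
    rw [vv_eq (im_pow_pos hτ n)]
    rfl
  rw [hc] at hl2
  have h5 := tendsto_nhds_unique tendsto_const_nhds hl2
  have h6 := theta4_ne_zero hτ
  rw [div_eq_iff (by positivity)] at h5
  linear_combination h5

/-- Second derivative identity. -/
lemma ss_sub_ww {τ : ℂ} (hτ : 0 < τ.im) : ww τ = ss τ - theta2 τ ^ 4 / 4 := by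
  have h1 := theta_ne_zero hτ
  have h2 := theta4_ne_zero hτ
  have ha := rel_theta hτ
  have hb := rel_theta4 hτ
  have hv := vv_sub_ss (two_mul_im hτ)
  have h4 := theta4_two_pow4 hτ
  have hq := theta_sq hτ
  have hq4 := theta4_sq hτ
  have hq2 := theta2_sq hτ
  have hq2' : theta2 τ ^ 4 = 4 * theta (2 * τ) ^ 2 * theta2 (2 * τ) ^ 2 := by
    linear_combination (theta2 τ ^ 2 + 2 * theta (2 * τ) * theta2 (2 * τ)) * hq2
  rw [hv, h4] at ha hb
  rw [hq2']
  have h3 : theta τ ^ 2 * theta4 τ ^ 2 ≠ 0 := by positivity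
  apply mul_left_cancel₀ h3
  rw [show theta τ ^ 2 * theta4 τ ^ 2 * ww τ = theta τ ^ 2 * (theta4 τ ^ 2 * ww τ) by ring, hb,
    mul_sub (theta τ ^ 2 * theta4 τ ^ 2), show theta τ ^ 2 * theta4 τ ^ 2 * ss τ = theta4 τ ^ 2 * (theta τ ^ 2 * ss τ) by ring, ha,
    hq, hq4]
  ring

/-- Jacobi identity. -/
lemma jacobi {τ : ℂ} (hτ : 0 < τ.im) : theta2 τ ^ 4 = theta τ ^ 4 - theta4 τ ^ 4 := by
  have hq := theta_sq hτ
  have hq4 := theta4_sq hτ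
  have hq2 := theta2_sq hτ
  rw [show theta2 τ ^ 4 = (theta2 τ ^ 2) ^ 2 by ring, show theta τ ^ 4 = (theta τ ^ 2) ^ 2 by ring,
    show theta4 τ ^ 4 = (theta4 τ ^ 2) ^ 2 by ring, hq, hq4, hq2]
  ring

/-- normalized derivative of ss -/
def ds (τ : ℂ) : ℂ := (T2 τ * theta τ - T1 τ ^ 2) / theta τ ^ 2

lemma hs_ss {τ : ℂ} (hτ : 0 < τ.im) : HasDerivAt ss (Real.pi * Complex.I * ds τ) τ := by
  refine ((hd_T1 hτ).div (hd_theta hτ) (theta_ne_zero hτ)).congr_deriv ?_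
  unfold ds; ring

lemma rel_ss {τ : ℂ} (hτ : 0 < τ.im) : ss τ = 2 * ss (2 * τ) +
    (theta (2 * τ) ^ 2 * theta2 (2 * τ) ^ 2 - theta2 (2 * τ) ^ 4) / 2 := by
  have h1 := theta_ne_zero hτ
  have ha := rel_theta hτ
  rw [vv_sub_ss (two_mul_im hτ), theta4_two_pow4 hτ] at ha
  apply mul_left_cancel₀ (pow_ne_zero 2 h1)
  rw [ha]
  rw [theta4_sq hτ, theta_sq hτ]
  ring

lemma rel_ds {τ : ℂ} (hτ : 0 < τ.im) : ds τ = 4 * ds (2 * τ) +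
    (theta (2 * τ) ^ 2 * theta2 (2 * τ) ^ 2 * (8 * ss (2 * τ) + theta4 (2 * τ) ^ 4)
      - theta2 (2 * τ) ^ 4 * (8 * ss (2 * τ) + 2 * theta4 (2 * τ) ^ 4)) / 2 := by
  have h2 := two_mul_im hτ
  have ha := hd_two (hs_theta h2)
  have hb := hd_two (hs_theta2 h2)
  have h := deriv_eq_of_eqOn hτ (hs_ss hτ)
    (((hd_two (hs_ss h2)).const_mul 2).fun_add
      ((((ha.fun_pow 2).fun_mul (hb.fun_pow 2)).fun_sub (hb.fun_pow 4)).div_const 2)) (fun s hs => rel_ss hs)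
  rw [vv_sub_ss h2] at h
  apply mul_left_cancel₀ pi_I_ne
  push_cast at h
  linear_combination h

/-- defect of the Chazy type equation -/
def kk (τ : ℂ) : ℂ := ds τ - 2 * ss τ ^ 2 - theta2 τ ^ 4 * theta4 τ ^ 4 / 8

lemma kk_step {τ : ℂ} (hτ : 0 < τ.im) : kk τ = 4 * kk (2 * τ) := by
  unfold kk
  rw [rel_ds hτ, rel_ss hτ, show theta2 τ ^ 4 = (theta2 τ ^ 2) ^ 2 by ring, theta2_sq hτ,
    show theta4 τ ^ 4 = (theta4 τ ^ 2) ^ 2 by ring, theta4_two_pow4 hτ, theta_sq hτ, theta4_sq hτ]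
  ring

/-- Third derivative identity. -/
lemma ds_eq {τ : ℂ} (hτ : 0 < τ.im) : ds τ = 2 * ss τ ^ 2 + theta2 τ ^ 4 * theta4 τ ^ 4 / 8 := by
  have h1 := fun n => step_iter (f := kk) (m := 4) (fun τ hτ => kk_step hτ) hτ n
  have hT := tendsto_theta _ hτ (im_pow τ)
  have h4 := tendsto_theta4 hτ
  have hT0 := smT.decay_tendsto cT_zero _ hτ (im_pow τ)
  have hT0' := smT.decay_tendsto' cT_zero _ hτ (im_pow τ)
  have hT1 : Tendsto (fun n : ℕ => T1 (2 ^ n * τ)) atTop (𝓝 0) :=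
    smT.mul_exp.decay_tendsto' smT0 _ hτ (im_pow τ)
  have hT1' : Tendsto (fun n : ℕ => 4 ^ n * T1 (2 ^ n * τ)) atTop (𝓝 0) :=
    smT.mul_exp.decay_tendsto smT0 _ hτ (im_pow τ)
  have hT2 : Tendsto (fun n : ℕ => 4 ^ n * T2 (2 ^ n * τ)) atTop (𝓝 0) :=
    smT.mul_exp.mul_exp.decay_tendsto smT00 _ hτ (im_pow τ)
  have hR0 := smT.decay_tendsto cT_zero _ hτ (im_pow_add τ)
  have hR0' := smT.decay_tendsto' cT_zero _ hτ (im_pow_add τ)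
  have hq : ∀ f : ℕ → ℂ, Tendsto f atTop (𝓝 0) →
      Tendsto (fun n => 4 + 6 * f n + 4 * f n ^ 2 + f n ^ 3) atTop
        (𝓝 (4 + 6 * 0 + 4 * 0 ^ 2 + 0 ^ 3)) := by
    intro f hf
    exact (((hf.const_mul 6).const_add 4).add ((hf.pow 2).const_mul 4)).add (hf.pow 3)
  have hJ := ((hT0.mul (hq _ hT0')).sub (hR0.mul (hq _ hR0'))).mul ((h4.pow 4).div_const 8)
  have hD := ((hT2.mul hT).sub (hT1.mul hT1')).div (hT.pow 2) (by norm_num)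
  have hS := ((hT1.mul hT1').div (hT.pow 2) (by norm_num)).const_mul 2
  have hl := (hD.sub hS).sub hJ
  have hl2 : Tendsto (fun n : ℕ => 4 ^ n * kk (2 ^ n * τ)) atTop (𝓝 0) := by
    have e0 : ((0 * 1 - 0 * 0) / 1 ^ 2 - 2 * (0 * 0 / 1 ^ 2) -
      (0 * (4 + 6 * 0 + 4 * 0 ^ 2 + 0 ^ 3) - 0 * (4 + 6 * 0 + 4 * 0 ^ 2 + 0 ^ 3)) * (1 ^ 4 / 8) : ℂ)
        = 0 := by norm_num
    rw [e0] at hl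
    refine hl.congr (fun n => ?_)
    have hp := im_pow_pos hτ n
    unfold kk
    rw [jacobi hp]
    have e1 := theta_eq hp
    have e4 : theta4 (2 ^ n * τ) = 1 + SE cT eT (2 ^ n * τ + 1) := by
      rw [theta4_eq, theta_eq (by simpa using hp)]
    have e5 : (4 : ℂ) ^ n * (theta (2 ^ n * τ) ^ 4 - theta4 (2 ^ n * τ) ^ 4) =
      4 ^ n * SE cT eT (2 ^ n * τ) * (4 + 6 * SE cT eT (2 ^ n * τ) + 4 * SE cT eT (2 ^ n * τ) ^ 2
        + SE cT eT (2 ^ n * τ) ^ 3) - 4 ^ n * SE cT eT (2 ^ n * τ + 1) * (4 + 6 * SE cT eT (2 ^ n * τ + 1)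
         + 4 * SE cT eT (2 ^ n * τ + 1) ^ 2 + SE cT eT (2 ^ n * τ + 1) ^ 3) := by
      rw [e1, e4]; ring
    simp only [Pi.div_apply]
    rw [← e5]
    unfold ds ss
    ring
  have hc : (fun n : ℕ => 4 ^ n * kk (2 ^ n * τ)) = fun _ => kk τ := by
    funext n; exact (h1 n).symm
  rw [hc] at hl2
  have h5 := tendsto_nhds_unique tendsto_const_nhds hl2
  unfold kk at h5
  linear_combination h5


/-! ### Formal part -/

/-- The exponential power series. -/
def eps (A : ℂ) : PowerSeries ℂ := PowerSeries.mk (fun i => A ^ i / (Nat.factorial i : ℂ))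

lemma eps_eq (A : ℂ) : eps A = PowerSeries.rescale A (PowerSeries.exp ℂ) := by
  ext n
  simp [eps, PowerSeries.coeff_rescale, PowerSeries.coeff_exp, div_eq_mul_inv]

lemma eps_neg (A : ℂ) : eps (-A) * eps A = 1 := by
  rw [eps_eq, eps_eq, PowerSeries.exp_mul_exp_eq_exp_add]
  simp

lemma eps_shift (A c : ℂ) :
    PowerSeries.mk (fun i : ℕ => (i : ℂ) * A ^ (i - 1) * c / (Nat.factorial i : ℂ))
      = PowerSeries.C c * (PowerSeries.X * eps A) := by
  ext n
  rw [PowerSeries.coeff_C_mul]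
  cases n with
  | zero => simp
  | succ n =>
    rw [PowerSeries.coeff_succ_X_mul, eps, PowerSeries.coeff_mk, PowerSeries.coeff_mk,
      Nat.factorial_succ]
    have : (Nat.factorial n : ℂ) ≠ 0 := by exact_mod_cast Nat.factorial_ne_zero n
    have h2 : (n : ℂ) + 1 ≠ 0 := by exact_mod_cast Nat.succ_ne_zero n
    push_cast
    field_simp
    try simp

lemma eps_deriv (A : ℂ) : PowerSeries.derivative ℂ (eps A) = PowerSeries.C A * eps A := by
  ext n
  rw [PowerSeries.coeff_C_mul, PowerSeries.coeff_derivative, eps, PowerSeries.coeff_mk,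
    PowerSeries.coeff_mk, Nat.factorial_succ]
  have : (Nat.factorial n : ℂ) ≠ 0 := by exact_mod_cast Nat.factorial_ne_zero n
  have h2 : (n : ℂ) + 1 ≠ 0 := by exact_mod_cast Nat.succ_ne_zero n
  push_cast
  field_simp
  ring

lemma formal_step (w A q dA p : ℂ) (H dH : ℕ → ℂ) (hq : q = A ^ 2 + p * dA)
    (h0 : w * H 1 + (w * A * H 0 + p * dH 0) = 0)
    (hn : ∀ n : ℕ, ((n : ℂ) + 2) * ((n : ℂ) + 1 + w) * H (n + 2)
      + ((2 * ((n : ℂ) + 1) + w) * A * H (n + 1) + p * dH (n + 1)) + q * H n = 0) (n : ℕ) :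
    ((n : ℂ) + 1) * ((n : ℂ) + w) * PowerSeries.coeff (n + 1) (eps A * PowerSeries.mk H)
      + p * PowerSeries.coeff n (PowerSeries.C dA * (PowerSeries.X * eps A) * PowerSeries.mk H
        + eps A * PowerSeries.mk dH) = 0 := by
  set D := PowerSeries.derivative ℂ with hD
  set X : PowerSeries ℂ := PowerSeries.X with hX
  let C : ℂ → PowerSeries ℂ := fun c => PowerSeries.C c
  have e1 : X * D (D (PowerSeries.mk H)) + C w * D (PowerSeries.mk H)
      + C 2 * C A * (X * D (PowerSeries.mk H)) + C w * C A * PowerSeries.mk H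
      + C p * PowerSeries.mk dH + C q * (X * PowerSeries.mk H) = 0 := by
    ext m
    simp only [C, mul_assoc, map_add, PowerSeries.coeff_C_mul, map_zero, hD, hX]
    cases m with
    | zero =>
      simp [PowerSeries.coeff_derivative]
      linear_combination h0
    | succ m =>
      simp only [PowerSeries.coeff_succ_X_mul, PowerSeries.coeff_derivative, PowerSeries.coeff_mk]
      push_cast
      linear_combination hn m
  have e2 : D (eps A) = C A * eps A := eps_deriv A
  have e3 : ∀ c, D (C c) = 0 := fun c => PowerSeries.derivative_C
  have e4 : X * D (D (eps A * PowerSeries.mk H)) + C w * D (eps A * PowerSeries.mk H)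
      + C p * (C dA * (X * eps A) * PowerSeries.mk H + eps A * PowerSeries.mk dH) = 0 := by
    have hqC : C q = C A * C A + C p * C dA := by
      simp only [C]; rw [hq]; simp [sq]
    have h2C : C 2 = 2 := map_ofNat PowerSeries.C 2
    rw [hqC, h2C] at e1
    simp only [Derivation.leibniz, smul_eq_mul, map_add, e2, e3]
    linear_combination (eps A) * e1
  have e5 := congrArg (PowerSeries.coeff n) e4
  simp only [C, mul_assoc, map_add, PowerSeries.coeff_C_mul, map_zero, hD, hX] at e5
  simp only [mul_assoc, map_add, PowerSeries.coeff_C_mul, hX]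
  rw [← e5]
  clear e5 e4 e1
  generalize eps A * PowerSeries.mk H = K
  cases n with
  | zero =>
    simp only [PowerSeries.coeff_zero_X_mul, PowerSeries.coeff_derivative]
    push_cast
    ring
  | succ n =>
    simp only [PowerSeries.coeff_succ_X_mul, PowerSeries.coeff_derivative]
    push_cast
    ring

lemma hasDerivAt_coeff_mul {f g : ℕ → ℂ → ℂ} {f' g' : ℕ → ℂ} {τ : ℂ}
    (hf : ∀ n, HasDerivAt (f n) (f' n) τ) (hg : ∀ n, HasDerivAt (g n) (g' n) τ) (n : ℕ) :
    HasDerivAt (fun s => PowerSeries.coeff n (PowerSeries.mk (fun i => f i s) *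
      PowerSeries.mk (fun i => g i s)))
      (PowerSeries.coeff n (PowerSeries.mk f' * PowerSeries.mk (fun i => g i τ)
        + PowerSeries.mk (fun i => f i τ) * PowerSeries.mk g')) τ := by
  simp only [map_add, PowerSeries.coeff_mul, PowerSeries.coeff_mk]
  rw [← Finset.sum_add_distrib]
  exact HasDerivAt.fun_sum (fun i _ => (hf i.1).fun_mul (hg i.2))

lemma formal_main (w p : ℂ) (hw : ∀ n : ℕ, (n : ℂ) + w ≠ 0) (A dA q : ℂ → ℂ) (H dH g dg : ℕ → ℂ → ℂ)
    (hA : ∀ τ : ℂ, 0 < τ.im → HasDerivAt A (Real.pi * Complex.I * dA τ) τ)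
    (hH : ∀ n, ∀ τ : ℂ, 0 < τ.im → HasDerivAt (H n) (Real.pi * Complex.I * dH n τ) τ)
    (hg : ∀ n, ∀ τ : ℂ, 0 < τ.im → HasDerivAt (g n) (Real.pi * Complex.I * dg n τ) τ)
    (hq : ∀ τ : ℂ, 0 < τ.im → q τ = A τ ^ 2 + p * dA τ)
    (h0 : ∀ τ : ℂ, 0 < τ.im → w * H 1 τ + (w * A τ * H 0 τ + p * dH 0 τ) = 0)
    (hn : ∀ τ : ℂ, 0 < τ.im → ∀ n : ℕ, ((n : ℂ) + 2) * ((n : ℂ) + 1 + w) * H (n + 2) τ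
      + ((2 * ((n : ℂ) + 1) + w) * A τ * H (n + 1) τ + p * dH (n + 1) τ) + q τ * H n τ = 0)
    (hg0 : ∀ τ : ℂ, 0 < τ.im → g 0 τ = H 0 τ)
    (hgn : ∀ τ : ℂ, 0 < τ.im → ∀ n : ℕ, ((n : ℂ) + 1) * ((n : ℂ) + w) * g (n + 1) τ + p * dg n τ = 0)
    (n : ℕ) : ∀ τ : ℂ, 0 < τ.im →
      g n τ = PowerSeries.coeff n (eps (A τ) * PowerSeries.mk (fun i => H i τ)) := by
  induction n with
  | zero =>
    intro τ hτ
    rw [hg0 τ hτ]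
    simp [PowerSeries.coeff_mul, eps]
  | succ n ih =>
    intro τ hτ
    have h1 := formal_step w (A τ) (q τ) (dA τ) p (fun i => H i τ) (fun i => dH i τ) (hq τ hτ)
      (h0 τ hτ) (hn τ hτ) n
    have hE : ∀ i : ℕ, HasDerivAt (fun s => A s ^ i / (Nat.factorial i : ℂ))
        ((i : ℂ) * A τ ^ (i - 1) * (Real.pi * Complex.I * dA τ) / (Nat.factorial i : ℂ)) τ :=
      fun i => ((hA τ hτ).fun_pow i).div_const _
    have h2 := hasDerivAt_coeff_mul hE (fun i => hH i τ hτ) n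
    have h3 := deriv_eq_of_eqOn hτ (hg n τ hτ) h2 ih
    rw [eps_shift] at h3
    have h4 : PowerSeries.mk (fun i => Real.pi * Complex.I * dH i τ)
        = PowerSeries.C (Real.pi * Complex.I : ℂ) * PowerSeries.mk (fun i => dH i τ) := by
      ext i; rw [PowerSeries.coeff_C_mul, PowerSeries.coeff_mk, PowerSeries.coeff_mk]
    have h5 : (PowerSeries.C (Real.pi * Complex.I * dA τ) : PowerSeries ℂ) =
      PowerSeries.C (Real.pi * Complex.I : ℂ) * PowerSeries.C (dA τ) := by rw [map_mul]
    rw [h4, h5] at h3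
    have h6 : dg n τ = PowerSeries.coeff n (PowerSeries.C (dA τ) * (PowerSeries.X * eps (A τ))
        * PowerSeries.mk (fun i => H i τ) + eps (A τ) * PowerSeries.mk (fun i => dH i τ)) := by
      apply mul_left_cancel₀ pi_I_ne
      rw [h3, ← PowerSeries.coeff_C_mul]
      congr 1
      change _ + eps (A τ) * _ = _
      ring
    have h7 := hgn τ hτ n
    rw [h6] at h7
    have h8 : ((n : ℂ) + 1) * ((n : ℂ) + w) ≠ 0 :=
      mul_ne_zero (by exact_mod_cast Nat.succ_ne_zero n) (hw n)
    apply mul_left_cancel₀ h8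
    linear_combination h7 - h1

/-! ### The coefficients on the right-hand side -/

lemma hl_mul {f g : ℂ → ℂ} {l m τ : ℂ} (hf : HasDerivAt f (Real.pi * Complex.I * (f τ * l)) τ)
    (hg : HasDerivAt g (Real.pi * Complex.I * (g τ * m)) τ) :
    HasDerivAt (fun s => f s * g s) (Real.pi * Complex.I * (f τ * g τ * (l + m))) τ :=
  (hf.fun_mul hg).congr_deriv (by ring)

lemma hl_pow {f : ℂ → ℂ} {l τ : ℂ} (hf : HasDerivAt f (Real.pi * Complex.I * (f τ * l)) τ) (n : ℕ) :
    HasDerivAt (fun s => f s ^ n) (Real.pi * Complex.I * (f τ ^ n * (n * l))) τ := by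
  refine (hf.fun_pow n).congr_deriv ?_
  cases n with
  | zero => simp
  | succ n => simp [pow_succ]; ring

lemma xx_ne_zero {τ : ℂ} (hτ : 0 < τ.im) : xx τ ≠ 0 := by
  unfold xx; exact neg_ne_zero.2 (pow_ne_zero _ (theta4_ne_zero hτ))

lemma yy_eq {τ : ℂ} (hτ : 0 < τ.im) : theta2 τ ^ 4 = uu τ * xx τ := by
  have := xx_ne_zero hτ
  unfold uu; field_simp; rfl

lemma hl_xx {τ : ℂ} (hτ : 0 < τ.im) :
    HasDerivAt xx (Real.pi * Complex.I * (xx τ * (4 * ww τ))) τ := by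
  have := (hl_pow (hs_theta4 hτ) 4).fun_neg
  refine this.congr_deriv ?_
  unfold xx; push_cast; ring

lemma hl_uu {τ : ℂ} (hτ : 0 < τ.im) :
    HasDerivAt uu (Real.pi * Complex.I * ((uu τ ^ 2 - uu τ) * xx τ)) τ := by
  have h1 := (hl_pow (hs_theta2 hτ) 4).fun_div (hl_xx hτ) (xx_ne_zero hτ)
  refine h1.congr_deriv ?_
  have hx := xx_ne_zero hτ
  have hy := yy_eq hτ
  have h4 : theta4 τ ^ 4 = - xx τ := by unfold xx; ring
  rw [vv_sub_ss hτ, ss_sub_ww hτ, h4, hy]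
  field_simp
  push_cast
  ring

lemma hl_F (a b4 c4 : ℕ) {τ : ℂ} (hτ : 0 < τ.im) :
    HasDerivAt (fun s => (theta2 s) ^ (4 * a) * (theta4 s) ^ b4 * (theta s) ^ c4)
      (Real.pi * Complex.I * ((theta2 τ) ^ (4 * a) * (theta4 τ) ^ b4 * (theta τ) ^ c4 *
        (2 * (2 * a + b4 / 2 + c4 / 2) * ss τ - a * xx τ - b4 / 4 * (uu τ * xx τ)))) τ := by
  have h1 := hl_mul (hl_mul (hl_pow (hs_theta2 hτ) (4 * a)) (hl_pow (hs_theta4 hτ) b4))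
    (hl_pow (hs_theta hτ) c4)
  refine h1.congr_deriv ?_
  have hy := yy_eq hτ
  have h4 : theta4 τ ^ 4 = - xx τ := by unfold xx; ring
  rw [vv_sub_ss hτ, ss_sub_ww hτ, h4, hy]
  push_cast
  ring

lemma AA_eq {τ : ℂ} (hτ : 0 < τ.im) : AA τ = -2 * (Real.pi : ℂ) ^ 2 * ss τ := by
  have h := theta_ne_zero hτ
  have hp : (Real.pi : ℂ) ≠ 0 := by exact_mod_cast Real.pi_ne_zero
  unfold AA tt
  rw [(hs_theta hτ).deriv]
  field_simp
  ring

lemma hd_AA {τ : ℂ} (hτ : 0 < τ.im) :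
    HasDerivAt AA (Real.pi * Complex.I * (-2 * (Real.pi : ℂ) ^ 2 * ds τ)) τ := by
  have h1 := (hs_ss hτ).const_mul (-2 * (Real.pi : ℂ) ^ 2)
  refine (h1.congr_of_eventuallyEq ?_).congr_deriv (by ring)
  filter_upwards [ev_H hτ] with s hs using AA_eq hs

lemma AA_q {τ : ℂ} (hτ : 0 < τ.im) : (Real.pi : ℂ) ^ 4 * xx τ ^ 2 * uu τ / 4 =
    AA τ ^ 2 + (Real.pi : ℂ) ^ 2 * (-2 * (Real.pi : ℂ) ^ 2 * ds τ) := by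
  have hy := yy_eq hτ
  have h4 : theta4 τ ^ 4 = - xx τ := by unfold xx; ring
  rw [AA_eq hτ, ds_eq hτ, h4, hy]
  ring

/-- The coefficients on the right-hand side. -/
def HH (F : ℂ → ℂ) (φ : ℕ → Polynomial ℚ) (n : ℕ) (τ : ℂ) : ℂ :=
  F τ * ((Real.pi : ℂ) ^ (2 * n) * (xx τ) ^ n * Polynomial.aeval (uu τ) (φ n))

/-- Their derivatives. -/
def dHH (a b4 c4 : ℕ) (F : ℂ → ℂ) (φ : ℕ → Polynomial ℚ) (n : ℕ) (τ : ℂ) : ℂ :=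
  F τ * ((Real.pi : ℂ) ^ (2 * n) * (xx τ) ^ n) *
    ((2 * (2 * a + b4 / 2 + c4 / 2) * ss τ - a * xx τ - b4 / 4 * (uu τ * xx τ)
      + n * (4 * ww τ)) * Polynomial.aeval (uu τ) (φ n)
      + Polynomial.aeval (uu τ) (Polynomial.derivative (φ n)) * ((uu τ ^ 2 - uu τ) * xx τ))

lemma hd_HH (a b4 c4 : ℕ) (F : ℂ → ℂ)
    (hF : ∀ τ : ℂ, F τ = (theta2 τ) ^ (4 * a) * (theta4 τ) ^ b4 * (theta τ) ^ c4)
    (φ : ℕ → Polynomial ℚ) (n : ℕ) {τ : ℂ} (hτ : 0 < τ.im) :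
    HasDerivAt (HH F φ n) (Real.pi * Complex.I * dHH a b4 c4 F φ n τ) τ := by
  have hF2 : F = fun s => (theta2 s) ^ (4 * a) * (theta4 s) ^ b4 * (theta s) ^ c4 := funext hF
  have h1 := hl_F a b4 c4 hτ
  have h2 := hl_pow (hl_xx hτ) n
  have h3 : HasDerivAt (fun s => Polynomial.aeval (uu s) (φ n)) _ τ :=
    HasDerivAt.comp τ (Polynomial.hasDerivAt_aeval (φ n) (uu τ)) (hl_uu hτ)
  have h4 := (hl_mul h1 h2).fun_mul h3
  have h5 := h4.const_mul ((Real.pi : ℂ) ^ (2 * n))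
  have h6 : HH F φ n = fun s => (Real.pi : ℂ) ^ (2 * n) *
    ((theta2 s) ^ (4 * a) * (theta4 s) ^ b4 * (theta s) ^ c4 * xx s ^ n *
      Polynomial.aeval (uu s) (φ n)) := by
    funext s; simp only [HH, hF]; ring
  rw [h6]
  refine h5.congr_deriv ?_
  simp only [dHH, hF]
  ring

lemma phi_eval (a b4 c4 : ℕ) (φ : ℕ → Polynomial ℚ)
    (hφrec : ∀ n : ℕ,
      (((n : ℚ) + 1) * ((n : ℚ) + (2 * a + b4 / 2 + c4 / 2))) • φ (n + 1)
        + (X ^ 2 - X) * Polynomial.derivative (φ n)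
        - (Polynomial.C (a : ℚ) + ((n : ℚ) + b4 / 4) • X) * φ n
        + (1/4 : ℚ) • (X * (if n = 0 then 0 else φ (n - 1))) = 0) (n : ℕ) (u : ℂ) :
    (((n : ℂ) + 1) * ((n : ℂ) + (2 * a + b4 / 2 + c4 / 2))) * Polynomial.aeval u (φ (n + 1))
        + (u ^ 2 - u) * Polynomial.aeval u (Polynomial.derivative (φ n))
        - (a + ((n : ℂ) + b4 / 4) * u) * Polynomial.aeval u (φ n)
        + (1/4) * (u * (if n = 0 then 0 else Polynomial.aeval u (φ (n - 1)))) = 0 := by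
  have h := congrArg (Polynomial.aeval u) (hφrec n)
  simp only [map_add, map_sub, map_mul, map_smul, map_pow, Polynomial.aeval_X, Polynomial.aeval_C,
    map_zero, apply_ite (Polynomial.aeval u)] at h
  simp only [Algebra.smul_def, eq_ratCast] at h
  push_cast at h
  exact h

lemma HH_zero (a b4 c4 : ℕ) (F : ℂ → ℂ) (φ : ℕ → Polynomial ℚ)
    (hφrec : ∀ n : ℕ,
      (((n : ℚ) + 1) * ((n : ℚ) + (2 * a + b4 / 2 + c4 / 2))) • φ (n + 1)
        + (X ^ 2 - X) * Polynomial.derivative (φ n)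
        - (Polynomial.C (a : ℚ) + ((n : ℚ) + b4 / 4) • X) * φ n
        + (1/4 : ℚ) • (X * (if n = 0 then 0 else φ (n - 1))) = 0) {τ : ℂ} (hτ : 0 < τ.im) :
    (2 * a + b4 / 2 + c4 / 2 : ℂ) * HH F φ 1 τ + ((2 * a + b4 / 2 + c4 / 2) * AA τ * HH F φ 0 τ
      + (Real.pi : ℂ) ^ 2 * dHH a b4 c4 F φ 0 τ) = 0 := by
  have h := phi_eval a b4 c4 φ hφrec 0 (uu τ)
  simp only [if_true, Nat.cast_zero] at h
  rw [AA_eq hτ]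
  simp only [HH, dHH, Nat.cast_zero]
  linear_combination F τ * (Real.pi : ℂ) ^ 2 * xx τ * h

lemma HH_succ (a b4 c4 : ℕ) (F : ℂ → ℂ) (φ : ℕ → Polynomial ℚ)
    (hφrec : ∀ n : ℕ,
      (((n : ℚ) + 1) * ((n : ℚ) + (2 * a + b4 / 2 + c4 / 2))) • φ (n + 1)
        + (X ^ 2 - X) * Polynomial.derivative (φ n)
        - (Polynomial.C (a : ℚ) + ((n : ℚ) + b4 / 4) • X) * φ n
        + (1/4 : ℚ) • (X * (if n = 0 then 0 else φ (n - 1))) = 0) {τ : ℂ} (hτ : 0 < τ.im) (n : ℕ) :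
    ((n : ℂ) + 2) * ((n : ℂ) + 1 + (2 * a + b4 / 2 + c4 / 2)) * HH F φ (n + 2) τ
      + ((2 * ((n : ℂ) + 1) + (2 * a + b4 / 2 + c4 / 2)) * AA τ * HH F φ (n + 1) τ
      + (Real.pi : ℂ) ^ 2 * dHH a b4 c4 F φ (n + 1) τ)
      + (Real.pi : ℂ) ^ 4 * xx τ ^ 2 * uu τ / 4 * HH F φ n τ = 0 := by
  have h := phi_eval a b4 c4 φ hφrec (n + 1) (uu τ)
  simp only [Nat.add_eq_zero_iff, one_ne_zero, and_false, if_false, Nat.add_sub_cancel] at h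
  push_cast at h
  rw [AA_eq hτ]
  simp only [HH, dHH]
  rw [ss_sub_ww hτ, yy_eq hτ]
  push_cast
  linear_combination F τ * (Real.pi : ℂ) ^ (2 * (n + 2)) * xx τ ^ (n + 2) * h

/-! ### The left-hand side as a double series -/

/-- coefficients of the Bessel-type function -/
def dd (w : ℝ) (k : ℕ) : ℝ := Real.Gamma w / ((Nat.factorial k : ℝ) * Real.Gamma (k + w))

lemma dd_pos {w : ℝ} (hw : 0 < w) (k : ℕ) : 0 < dd w k := by
  unfold dd
  have h1 := Real.Gamma_pos_of_pos hw
  have h2 : 0 < Real.Gamma (k + w) := Real.Gamma_pos_of_pos (by positivity)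
  positivity

lemma dd_zero {w : ℝ} (hw : 0 < w) : dd w 0 = 1 := by
  have h1 := (Real.Gamma_pos_of_pos hw).ne'
  simp [dd, h1]

lemma dd_succ {w : ℝ} (hw : 0 < w) (k : ℕ) : ((k : ℝ) + 1) * (k + w) * dd w (k + 1) = dd w k := by
  unfold dd
  have h0 : (k : ℝ) + w ≠ 0 := by positivity
  have h2 := (Real.Gamma_pos_of_pos (show 0 < (k : ℝ) + w by positivity)).ne'
  have h3 : ((k + 1 : ℕ) : ℝ) + w = (k + w) + 1 := by push_cast; ring
  rw [h3, Real.Gamma_add_one h0, Nat.factorial_succ]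
  push_cast
  field_simp

lemma jw_eq (w : ℝ) (v : ℂ) : jw (w - 1) v = ∑' k : ℕ, (-1 : ℂ) ^ k * (dd w k : ℂ) * v ^ k := by
  unfold jw dd
  refine tsum_congr fun k => ?_
  rw [sub_add_cancel, show (k : ℝ) + (w - 1) + 1 = k + w by ring]
  push_cast
  ring

lemma dd_bound {w : ℝ} (hw : 0 < w) {r : ℝ} (hr : 0 ≤ r) :
    ∃ M : ℝ, 0 ≤ M ∧ ∀ k : ℕ, dd w k * r ^ k * (Nat.factorial k : ℝ) ≤ M := by
  have hs : Summable (fun k : ℕ => dd w k * r ^ k * (Nat.factorial k : ℝ)) := by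
    refine summable_of_ratio_norm_eventually_le (r := 1 / 2) (by norm_num) ?_
    filter_upwards [eventually_ge_atTop (Nat.ceil (2 * r))] with k hk
    have hk2 : 2 * r ≤ k := Nat.ceil_le.1 hk
    have h1 := dd_succ hw k
    have hp := dd_pos hw (k + 1)
    rw [Real.norm_of_nonneg (by positivity),
      Real.norm_of_nonneg (mul_nonneg (mul_nonneg (dd_pos hw k).le (by positivity)) (by positivity)),
      ← h1, Nat.factorial_succ, pow_succ]
    push_cast
    have : 0 ≤ dd w (k + 1) * r ^ k * (Nat.factorial k : ℝ) * (k + 1) := by positivity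
    nlinarith [mul_nonneg this (show 0 ≤ (k : ℝ) + w - 2 * r by linarith)]
  have hnn : ∀ k : ℕ, 0 ≤ dd w k * r ^ k * (Nat.factorial k : ℝ) := fun k =>
    mul_nonneg (mul_nonneg (dd_pos hw k).le (by positivity)) (by positivity)
  exact ⟨_, tsum_nonneg hnn, fun k => hs.le_tsum k (fun j _ => hnn j)⟩

/-- General term of the double series. -/
def tm (w : ℝ) (c : ℕ → ℂ) (τ z : ℂ) (n k : ℕ) : ℂ :=
  c n * ((-1 : ℂ) ^ k * (dd w k : ℂ) * ((Real.pi : ℂ) ^ 2 * n * z) ^ k) *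
    Complex.exp (Real.pi * Complex.I * n * τ)

lemma tm_summable {w : ℝ} (hw : 0 < w) {c : ℕ → ℂ} (hc : SmE c (fun n => n)) {τ : ℂ} (hτ : 0 < τ.im)
    (z : ℂ) : Summable (fun p : ℕ × ℕ => ‖tm w c τ z p.1 p.2‖) := by
  set ε : ℝ := Real.pi * τ.im / 2 with hε
  have hεp : 0 < ε := by have := Real.pi_pos; positivity
  set R : ℝ := Real.pi ^ 2 * ‖z‖ with hR
  have hR0 : 0 ≤ R := by positivity
  obtain ⟨M, hM, hb⟩ := dd_bound hw (r := R / ε) (by positivity)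
  have hc2 := hc (τ / 2) (by simpa using hτ)
  have hnorm : ∀ n k : ℕ, ‖tm w c τ z n k‖ ≤
      M * (‖c n * Complex.exp (Real.pi * Complex.I * n * τ)‖ * ((ε * n) ^ k / (Nat.factorial k : ℝ))) := by
    intro n k
    have hk : (0 : ℝ) < Nat.factorial k := by positivity
    have e1 : ‖tm w c τ z n k‖ = ‖c n * Complex.exp (Real.pi * Complex.I * n * τ)‖ *
        (dd w k * (R * n) ^ k) := by
      unfold tm
      simp only [norm_mul, norm_pow, norm_neg, norm_one, one_pow, one_mul, Complex.norm_real,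
        Complex.norm_natCast, Real.norm_of_nonneg (dd_pos hw k).le, Real.norm_of_nonneg Real.pi_pos.le, hR]
      ring
    have e2 : dd w k * (R * n) ^ k = (dd w k * (R / ε) ^ k * (Nat.factorial k : ℝ)) *
        ((ε * n) ^ k / (Nat.factorial k : ℝ)) := by
      have e3 : R * n = R / ε * (ε * n) := by field_simp
      rw [e3, mul_pow (R / ε)]
      field_simp
    rw [e1, e2]
    have h3 : 0 ≤ (ε * n) ^ k / (Nat.factorial k : ℝ) := by positivity
    calc _ = (dd w k * (R / ε) ^ k * (Nat.factorial k : ℝ)) *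
        (‖c n * Complex.exp (Real.pi * Complex.I * n * τ)‖ * ((ε * n) ^ k / (Nat.factorial k : ℝ))) := by ring
      _ ≤ _ := mul_le_mul_of_nonneg_right (hb k) (mul_nonneg (norm_nonneg _) h3)
  have hexp : ∀ n : ℕ, HasSum (fun k : ℕ => M * (‖c n * Complex.exp (Real.pi * Complex.I * n * τ)‖ *
      ((ε * n) ^ k / (Nat.factorial k : ℝ))))
      (M * ‖c n * Complex.exp (Real.pi * Complex.I * n * (τ / 2))‖) := by
    intro n
    have h1 : HasSum (fun k : ℕ => (ε * n) ^ k / (Nat.factorial k : ℝ)) (Real.exp (ε * n)) := by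
      rw [Real.exp_eq_exp_ℝ]; exact NormedSpace.expSeries_div_hasSum_exp (ε * n)
    have h2 := (h1.mul_left ‖c n * Complex.exp (Real.pi * Complex.I * n * τ)‖).mul_left M
    suffices h3 : ‖c n * Complex.exp (Real.pi * Complex.I * n * (τ / 2))‖ =
        ‖c n * Complex.exp (Real.pi * Complex.I * n * τ)‖ * Real.exp (ε * n) by
      rw [h3]; exact h2
    rw [norm_mul, norm_mul, norm_expE, norm_expE, mul_assoc ‖c n‖, ← Real.exp_add]
    congr 2
    have him : (τ / 2).im = τ.im / 2 := by simp
    rw [him, hε]; ring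
  have hbig : Summable (fun p : ℕ × ℕ => M * (‖c p.1 * Complex.exp (Real.pi * Complex.I * p.1 * τ)‖ *
      ((ε * p.1) ^ p.2 / (Nat.factorial p.2 : ℝ)))) := by
    rw [summable_prod_of_nonneg (fun p => by positivity)]
    refine ⟨fun n => (hexp n).summable, ?_⟩
    simp only [fun n => (hexp n).tsum_eq]
    exact hc2.mul_left M
  exact Summable.of_nonneg_of_le (fun p => norm_nonneg _) (fun p => hnorm p.1 p.2) hbig

lemma lhs_term (w : ℝ) (c : ℕ → ℂ) (τ z : ℂ) (n : ℕ) :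
    c n * jw (w - 1) ((Real.pi : ℂ) ^ 2 * n * z) * Complex.exp (Real.pi * Complex.I * n * τ)
      = ∑' k, tm w c τ z n k := by
  rw [jw_eq]
  unfold tm
  rw [tsum_mul_right, tsum_mul_left]

lemma smE_pow {c : ℕ → ℂ} (hc : SmE c (fun n => n)) (k : ℕ) :
    SmE (fun n : ℕ => (n : ℂ) ^ k * c n) (fun n => n) := by
  induction k with
  | zero => simpa using hc
  | succ k ih =>
    have := ih.mul_exp
    convert this using 2 with n
    ring

/-- The coefficients on the left-hand side. -/
def gg (w : ℝ) (c : ℕ → ℂ) (k : ℕ) (τ : ℂ) : ℂ :=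
  (dd w k : ℂ) * (-(Real.pi : ℂ) ^ 2) ^ k * SE (fun n : ℕ => (n : ℂ) ^ k * c n) (fun n => n) τ

/-- Their derivatives. -/
def dgg (w : ℝ) (c : ℕ → ℂ) (k : ℕ) (τ : ℂ) : ℂ :=
  (dd w k : ℂ) * (-(Real.pi : ℂ) ^ 2) ^ k * SE (fun n : ℕ => (n : ℂ) ^ (k + 1) * c n) (fun n => n) τ

lemma hd_gg (w : ℝ) {c : ℕ → ℂ} (hc : SmE c (fun n => n)) (k : ℕ) {τ : ℂ} (hτ : 0 < τ.im) :
    HasDerivAt (gg w c k) (Real.pi * Complex.I * dgg w c k τ) τ := by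
  have h := ((smE_pow hc k).hasDerivAt hτ).const_mul ((dd w k : ℂ) * (-(Real.pi : ℂ) ^ 2) ^ k)
  refine h.congr_deriv ?_
  unfold dgg
  have : (fun n : ℕ => (n : ℂ) * ((n : ℂ) ^ k * c n)) = fun n : ℕ => (n : ℂ) ^ (k + 1) * c n := by
    funext n; ring
  rw [this]; ring

lemma gg_succ {w : ℝ} (hw : 0 < w) (c : ℕ → ℂ) (k : ℕ) (τ : ℂ) :
    ((k : ℂ) + 1) * ((k : ℂ) + w) * gg w c (k + 1) τ + (Real.pi : ℂ) ^ 2 * dgg w c k τ = 0 := by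
  have h : ((k : ℂ) + 1) * (k + w) * (dd w (k + 1) : ℂ) = dd w k := by exact_mod_cast dd_succ hw k
  unfold gg dgg
  rw [← h, pow_succ (-(Real.pi : ℂ) ^ 2)]
  ring

lemma gg_term (w : ℝ) (c : ℕ → ℂ) (τ z : ℂ) (k : ℕ) :
    ∑' n, tm w c τ z n k = gg w c k τ * z ^ k := by
  unfold gg SE
  rw [← tsum_mul_left, ← tsum_mul_right]
  refine tsum_congr fun n => ?_
  unfold tm
  rw [neg_pow, mul_pow, mul_pow]
  ring

lemma lhs_summable {w : ℝ} (hw : 0 < w) {c : ℕ → ℂ} (hc : SmE c (fun n => n)) {τ : ℂ} (hτ : 0 < τ.im)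
    (z : ℂ) : Summable (fun n : ℕ => ‖c n * jw (w - 1) ((Real.pi : ℂ) ^ 2 * n * z) *
      Complex.exp (Real.pi * Complex.I * n * τ)‖) := by
  have h := tm_summable hw hc hτ z
  have h2 := (summable_prod_of_nonneg (fun p => norm_nonneg _)).1 h
  refine Summable.of_nonneg_of_le (fun n => norm_nonneg _) (fun n => ?_) h2.2
  rw [lhs_term]
  exact norm_tsum_le_tsum_norm (h2.1 n)

lemma gg_summable {w : ℝ} (hw : 0 < w) {c : ℕ → ℂ} (hc : SmE c (fun n => n)) {τ : ℂ} (hτ : 0 < τ.im)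
    (z : ℂ) : Summable (fun k : ℕ => ‖gg w c k τ * z ^ k‖) := by
  have h := (tm_summable hw hc hτ z).prod_symm
  have h2 := (summable_prod_of_nonneg (fun p => norm_nonneg _)).1 h
  refine Summable.of_nonneg_of_le (fun n => norm_nonneg _) (fun k => ?_) h2.2
  rw [← gg_term]
  exact norm_tsum_le_tsum_norm (h2.1 k)

lemma lhs_eq {w : ℝ} (hw : 0 < w) {c : ℕ → ℂ} (hc : SmE c (fun n => n)) {τ : ℂ} (hτ : 0 < τ.im)
    (z : ℂ) : ∑' n : ℕ, c n * jw (w - 1) ((Real.pi : ℂ) ^ 2 * n * z) *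
      Complex.exp (Real.pi * Complex.I * n * τ) = ∑' k, gg w c k τ * z ^ k := by
  simp only [lhs_term, ← gg_term]
  have h : Summable (Function.uncurry (tm w c τ z)) := (tm_summable hw hc hτ z).of_norm
  exact h.tsum_comm.symm

/-! ### Conclusion -/

lemma final_sum (A z : ℂ) (g H : ℕ → ℂ)
    (h : ∀ n, g n = PowerSeries.coeff n (eps A * PowerSeries.mk H))
    (hg : Summable (fun k => ‖g k * z ^ k‖)) :
    Summable (fun k => ‖H k * z ^ k‖) ∧
      ∑' k, g k * z ^ k = Complex.exp (A * z) * ∑' k, H k * z ^ k := by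
  have hexp : ∀ v : ℂ, Summable (fun k : ℕ => ‖v ^ k / (Nat.factorial k : ℂ)‖) := fun v =>
    NormedSpace.norm_expSeries_div_summable v
  have hG : PowerSeries.mk g = eps A * PowerSeries.mk H := by
    ext n; rw [PowerSeries.coeff_mk, h]
  have hH : PowerSeries.mk H = eps (-A) * PowerSeries.mk g := by
    rw [hG, ← mul_assoc, eps_neg, one_mul]
  have hHn : ∀ n, H n * z ^ n = ∑ kl ∈ Finset.HasAntidiagonal.antidiagonal n,
      ((-A * z) ^ kl.1 / (Nat.factorial kl.1 : ℂ)) * (g kl.2 * z ^ kl.2) := by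
    intro n
    have := congrArg (PowerSeries.coeff n) hH
    rw [PowerSeries.coeff_mk, PowerSeries.coeff_mul] at this
    rw [this, Finset.sum_mul]
    refine Finset.sum_congr rfl fun kl hkl => ?_
    rw [Finset.HasAntidiagonal.mem_antidiagonal] at hkl
    rw [eps, PowerSeries.coeff_mk, PowerSeries.coeff_mk, ← hkl, mul_pow, pow_add]
    ring
  have hGn : ∀ n, g n * z ^ n = ∑ kl ∈ Finset.HasAntidiagonal.antidiagonal n,
      ((A * z) ^ kl.1 / (Nat.factorial kl.1 : ℂ)) * (H kl.2 * z ^ kl.2) := by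
    intro n
    rw [h, PowerSeries.coeff_mul, Finset.sum_mul]
    refine Finset.sum_congr rfl fun kl hkl => ?_
    rw [Finset.HasAntidiagonal.mem_antidiagonal] at hkl
    rw [eps, PowerSeries.coeff_mk, PowerSeries.coeff_mk, ← hkl, mul_pow, pow_add]
    ring
  have hs : Summable (fun k => ‖H k * z ^ k‖) := by
    have h5 := summable_norm_sum_mul_antidiagonal_of_summable_norm
      (f := fun k : ℕ => (-A * z) ^ k / (Nat.factorial k : ℂ)) (g := fun k => g k * z ^ k) (hexp _) hg
    refine h5.congr fun n => ?_
    rw [hHn n]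
  refine ⟨hs, ?_⟩
  rw [Complex.exp_eq_exp_ℂ, NormedSpace.exp_eq_tsum_div,
    tsum_mul_tsum_eq_tsum_sum_antidiagonal_of_summable_norm
      (f := fun k : ℕ => (A * z) ^ k / (Nat.factorial k : ℂ)) (g := fun k => H k * z ^ k) (hexp _) hs]
  exact tsum_congr hGn


/-- For `F = θ₂^{4a} θ₄^{4b} θ^{4c}` (with `a ∈ ℤ≥0`, `4b = b4`, `4c = c4` nonnegative
integers, `w = 2(a+b+c) > 0`), for every `τ ∈ ℍ` and `z ∈ ℂ`, both series converge absolutely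
and `∑_{n≥0} c_F(n) j_{w-1}(π²nz) e^{πinτ} = e^{A(τ)z} F(τ) ∑_{n≥0} π^{2n} x(τ)ⁿ φₙ(u(τ)) zⁿ`. -/
theorem cohen_kuznetsov_expansion_multiplicative_case
    (a b4 c4 : ℕ) (hw : 0 < 4 * a + b4 + c4)
    (F : ℂ → ℂ)
    (hF : ∀ τ : ℂ, F τ = (theta2 τ) ^ (4 * a) * (theta4 τ) ^ b4 * (theta τ) ^ c4)
    (φ : ℕ → Polynomial ℚ)
    (hφ0 : φ 0 = 1)
    (hφrec : ∀ n : ℕ,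
      (((n : ℚ) + 1) * ((n : ℚ) + (2 * a + b4 / 2 + c4 / 2))) • φ (n + 1)
        + (X ^ 2 - X) * Polynomial.derivative (φ n)
        - (Polynomial.C (a : ℚ) + ((n : ℚ) + b4 / 4) • X) * φ n
        + (1/4 : ℚ) • (X * (if n = 0 then 0 else φ (n - 1))) = 0)
    (cF : ℕ → ℂ)
    (hcFsum : ∀ τ : ℂ, 0 < τ.im →
      Summable (fun n : ℕ => ‖cF n * Complex.exp (Real.pi * Complex.I * n * τ)‖))
    (hcF : ∀ τ : ℂ, 0 < τ.im →
      F τ = ∑' n : ℕ, cF n * Complex.exp (Real.pi * Complex.I * n * τ))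
    (τ : ℂ) (hτ : 0 < τ.im) (z : ℂ) :
    Summable (fun n : ℕ =>
      ‖cF n * jw ((2 * a + b4 / 2 + c4 / 2 : ℝ) - 1) ((Real.pi : ℂ) ^ 2 * n * z) *
        Complex.exp (Real.pi * Complex.I * n * τ)‖) ∧
    Summable (fun n : ℕ => ‖(Real.pi : ℂ) ^ (2 * n) * (xx τ) ^ n *
      Polynomial.aeval (uu τ) (φ n) * z ^ n‖) ∧
    ∑' n : ℕ, cF n * jw ((2 * a + b4 / 2 + c4 / 2 : ℝ) - 1) ((Real.pi : ℂ) ^ 2 * n * z) *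
        Complex.exp (Real.pi * Complex.I * n * τ)
      = Complex.exp (AA τ * z) * F τ *
        ∑' n : ℕ, (Real.pi : ℂ) ^ (2 * n) * (xx τ) ^ n *
          Polynomial.aeval (uu τ) (φ n) * z ^ n := by
  set w : ℝ := (2 * a + b4 / 2 + c4 / 2 : ℝ) with hwdef
  have hw0 : 0 < w := by
    have h1 : (0 : ℝ) < 4 * a + b4 + c4 := by exact_mod_cast hw
    rw [hwdef]; linarith
  have hwc : ((w : ℝ) : ℂ) = 2 * a + b4 / 2 + c4 / 2 := by rw [hwdef]; push_cast; ring
  have hc : SmE cF (fun n => n) := hcFsum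
  have hwn : ∀ n : ℕ, (n : ℂ) + (w : ℂ) ≠ 0 := by
    intro n
    have : (n : ℝ) + w ≠ 0 := by positivity
    exact_mod_cast this
  have key := formal_main (w : ℂ) ((Real.pi : ℂ) ^ 2) hwn AA (fun s => -2 * (Real.pi : ℂ) ^ 2 * ds s)
    (fun s => (Real.pi : ℂ) ^ 4 * xx s ^ 2 * uu s / 4) (HH F φ) (dHH a b4 c4 F φ) (gg w cF) (dgg w cF)
    (fun s hs => hd_AA hs) (fun n s hs => hd_HH a b4 c4 F hF φ n hs) (fun n s hs => hd_gg w hc n hs)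
    (fun s hs => AA_q hs)
    (fun s hs => by rw [hwc]; exact HH_zero a b4 c4 F φ hφrec hs)
    (fun s hs n => by rw [hwc]; exact HH_succ a b4 c4 F φ hφrec hs n)
    (fun s hs => by
      simp only [gg, HH, SE, dd_zero hw0, hφ0]
      simp [hcF s hs])
    (fun s _ n => gg_succ hw0 cF n s)
  have hfin := final_sum (AA τ) z (fun n => gg w cF n τ) (fun n => HH F φ n τ)
    (fun n => key n τ hτ) (gg_summable hw0 hc hτ z)
  have hF0 : F τ ≠ 0 := by
    rw [hF]
    exact mul_ne_zero (mul_ne_zero (pow_ne_zero _ (theta2_ne_zero hτ))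
      (pow_ne_zero _ (theta4_ne_zero hτ))) (pow_ne_zero _ (theta_ne_zero hτ))
  have hterm : ∀ n : ℕ, HH F φ n τ * z ^ n = F τ * ((Real.pi : ℂ) ^ (2 * n) * (xx τ) ^ n *
      Polynomial.aeval (uu τ) (φ n) * z ^ n) := by
    intro n; unfold HH; ring
  refine ⟨lhs_summable hw0 hc hτ z, ?_, ?_⟩
  · have h1 := hfin.1
    simp only [hterm, norm_mul (F τ)] at h1
    exact (summable_mul_left_iff (norm_ne_zero_iff.2 hF0)).1 h1
  · rw [lhs_eq hw0 hc hτ z, hfin.2]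
    simp only [hterm]
    rw [tsum_mul_left, mul_assoc]
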